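/- Suppose r is a positive integer with gcd(r, 6) = 1, N is a positive integer, χ is a Dirichlet character modulo N, and f(z) ∈ S_k(N, χν_η^r). Then f(24z) ∈ S_k(576N, χ(12/•)ν_θ^r), i.e., z ↦ f(24z) is a cusp form of weight k on Γ₀(576N) with multiplier χ(12/•)ν_θ^r. -/

import Mathlib

open Complex UpperHalfPlane CongruenceSubgroup Matrix NumberField
open scoped Manifold MatrixGroups Real

noncomputable section

abbrev SL2Z := Matrix.SpecialLinearGroup (Fin 2) ℤ

/-- The automorphy denominator `c z + d` for `γ = (a b; c d)`. -/
def sldenom (γ : SL2Z) (z : ℍ) : ℂ := ((γ 1 0 : ℤ) : ℂ) * (z : ℂ) + ((γ 1 1 : ℤ) : ℂ)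

/-- `q^{n/24} = e^{2π i n z/24}`. -/
def q24 (n : ℕ) (z : ℍ) : ℂ := Complex.exp (2 * Real.pi * Complex.I * (n : ℂ) * (z : ℂ) / 24)

/-- The Dedekind eta function `η(z) = q^{1/24} ∏_{n≥1} (1 - qⁿ)`. -/
def dedekindEta (z : ℍ) : ℂ :=
  Complex.exp (Real.pi * Complex.I * (z : ℂ) / 12) *
    ∏' n : ℕ, (1 - Complex.exp (2 * Real.pi * Complex.I * ((n : ℂ) + 1) * (z : ℂ)))

/-- The Jacobi theta function `θ(z) = Σ_{n ∈ ℤ} q^{n²}`. -/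
def theta (z : ℍ) : ℂ := ∑' n : ℤ, Complex.exp (2 * Real.pi * Complex.I * ((n : ℂ)) ^ 2 * (z : ℂ))

/-- The eta multiplier `ν_η`, characterized by
`η(γz) = ν_η(γ) (cz+d)^{1/2} η(z)` (principal branch); we evaluate at `z = i`. -/
def nuEta (γ : SL2Z) : ℂ :=
  dedekindEta (γ • UpperHalfPlane.I) / (sldenom γ UpperHalfPlane.I ^ ((1 : ℂ) / 2) * dedekindEta UpperHalfPlane.I)

/-- The theta multiplier `ν_θ`, characterized by
`θ(γz) = ν_θ(γ) (cz+d)^{1/2} θ(z)` (principal branch) for `γ ∈ Γ₀(4)`. -/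
def nuTheta (γ : SL2Z) : ℂ :=
  theta (γ • UpperHalfPlane.I) /
    (sldenom γ UpperHalfPlane.I ^ ((1 : ℂ) / 2) * theta UpperHalfPlane.I)

/-- The Kronecker symbol `(12/n)`. -/
def kron12 (n : ℤ) : ℤ :=
  if n % 12 = 1 ∨ n % 12 = 11 then 1 else if n % 12 = 5 ∨ n % 12 = 7 then -1 else 0

/-- Holomorphic modular forms of (possibly half-integral) weight `k`, level `Γ₀(N)` and
multiplier system `ν`: holomorphy, transformation, and boundedness at all cusps. -/
def IsModForm (N : ℕ) (k : ℝ) (ν : SL2Z → ℂ) (f : ℍ → ℂ) : Prop :=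
  MDifferentiable 𝓘(ℂ) 𝓘(ℂ) f ∧
  (∀ γ ∈ Gamma0 N, ∀ z : ℍ, f (γ • z) = ν γ * sldenom γ z ^ (k : ℂ) * f z) ∧
  ∀ γ : SL2Z, IsBoundedAtImInfty fun z => sldenom γ z ^ (-(k : ℂ)) * f (γ • z)

/-- Cusp forms of (possibly half-integral) weight `k`, level `Γ₀(N)` and multiplier `ν`. -/
def IsCuspForm (N : ℕ) (k : ℝ) (ν : SL2Z → ℂ) (f : ℍ → ℂ) : Prop :=
  MDifferentiable 𝓘(ℂ) 𝓘(ℂ) f ∧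
  (∀ γ ∈ Gamma0 N, ∀ z : ℍ, f (γ • z) = ν γ * sldenom γ z ^ (k : ℂ) * f z) ∧
  ∀ γ : SL2Z, IsZeroAtImInfty fun z => sldenom γ z ^ (-(k : ℂ)) * f (γ • z)

/-- Weakly holomorphic modular forms: meromorphic at the cusps. -/
def IsWeakModForm (N : ℕ) (k : ℝ) (ν : SL2Z → ℂ) (f : ℍ → ℂ) : Prop :=
  MDifferentiable 𝓘(ℂ) 𝓘(ℂ) f ∧
  (∀ γ ∈ Gamma0 N, ∀ z : ℍ, f (γ • z) = ν γ * sldenom γ z ^ (k : ℂ) * f z) ∧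
  ∀ γ : SL2Z, ∃ m : ℕ, IsBoundedAtImInfty fun z =>
    q24 m z * (sldenom γ z ^ (-(k : ℂ)) * f (γ • z))

/-- `x ∈ K` is `v`-integral: it is a quotient `a/b` with `a, b ∈ 𝓞 K`, `b ∉ v`. -/
def VInt {K : Type*} [Field K] [NumberField K] (v : Ideal (𝓞 K)) (x : K) : Prop :=
  ∃ a b : 𝓞 K, b ∉ v ∧ (b : K) * x = (a : K)

/-- Congruence modulo `v` in the ring of `v`-integral elements of `K`. -/
def VCong {K : Type*} [Field K] [NumberField K] (v : Ideal (𝓞 K)) (x y : K) : Prop :=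
  ∃ a b : 𝓞 K, b ∉ v ∧ a ∈ v ∧ (b : K) * (x - y) = (a : K)

/-- The point `24 z` of the upper half-plane. -/
def smul24 (z : ℍ) : ℍ := ⟨24 * (z : ℂ), by
  have := z.2
  simp only [Complex.mul_im]
  norm_num
  simpa using this⟩

/-- Horizontal translation `z ↦ z + x` on the upper half-plane. -/
def hshift (x : ℝ) (z : ℍ) : ℍ := ⟨(z : ℂ) + (x : ℂ), by simpa using z.2⟩

/-- `ε_p`: `1` if `p ≡ 1 (mod 4)`, `i` if `p ≡ 3 (mod 4)`. -/
def epsP (p : ℕ) : ℂ := if p % 4 = 1 then 1 else Complex.I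

lemma coe_SL2Z_smul (γ : SL2Z) (z : ℍ) :
    ((γ • z : ℍ) : ℂ) = (((γ 0 0 : ℤ) : ℂ) * z + ((γ 0 1 : ℤ) : ℂ)) / sldenom γ z := by
  rw [UpperHalfPlane.coe_specialLinearGroup_apply]
  simp [sldenom]

lemma SL2Z_det (γ : SL2Z) : γ 0 0 * γ 1 1 - γ 0 1 * γ 1 0 = 1 := by
  rw [← Matrix.det_fin_two, γ.det_coe]

lemma sldenom_ne_zero (γ : SL2Z) (z : ℍ) : sldenom γ z ≠ 0 := by
  intro h
  have him := congrArg Complex.im h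
  have hre := congrArg Complex.re h
  simp [sldenom] at him hre
  have hdet := SL2Z_det γ
  rcases him with hc | hz
  · simp only [hc, Int.cast_zero, zero_mul, zero_add, Int.cast_eq_zero] at hre
    simp [hc, hre] at hdet
  · exact z.im_pos.ne' hz

lemma continuous_sldenom (γ : SL2Z) : Continuous (sldenom γ) := by
  unfold sldenom
  fun_prop

lemma continuous_sldenom_cpow (γ : SL2Z) (s : ℂ) : Continuous fun z ↦ sldenom γ z ^ s := by
  by_cases hc : γ 1 0 = 0
  · simp only [sldenom, hc, Int.cast_zero, zero_mul, zero_add]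
    exact continuous_const
  · refine (continuous_sldenom γ).cpow continuous_const fun z ↦ Or.inr ?_
    simp [sldenom, hc, z.im_pos.ne']

lemma continuous_SL2Z_smul (γ : SL2Z) : Continuous fun z : ℍ ↦ γ • z := by
  rw [UpperHalfPlane.isEmbedding_coe.continuous_iff]
  simp only [Function.comp_def, coe_SL2Z_smul]
  exact Continuous.div (by fun_prop) (continuous_sldenom γ) (sldenom_ne_zero γ)

lemma sldenom_mul (γ₁ γ₂ : SL2Z) (z : ℍ) :
    sldenom (γ₁ * γ₂) z = sldenom γ₁ (γ₂ • z) * sldenom γ₂ z := by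
  have h := sldenom_ne_zero γ₂ z
  rw [sldenom, sldenom, coe_SL2Z_smul]
  field_simp
  simp [sldenom, Matrix.mul_apply, Fin.sum_univ_two]
  ring

/-- The two-variable theta function `∑ e(n² z + n u)` transforms under `γ` like a Jacobi form of
weight `1/2`, with an unspecified continuous square root of `cz + d` up to scaling as the automorphy
factor. -/
def ThetaTransforms (γ : SL2Z) : Prop :=
  ∃ J : ℍ → ℂ, Continuous J ∧ (∃ C : ℂ, ∀ z, J z ^ 2 = C * sldenom γ z) ∧
    ∀ (u : ℂ) (z : ℍ), jacobiTheta₂ (u / sldenom γ z) (2 * (γ • z : ℍ)) =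
      J z * cexp (π * Complex.I * ((γ 1 0 : ℤ) : ℂ) * u ^ 2 / (2 * sldenom γ z)) *
        jacobiTheta₂ u (2 * z)

lemma ThetaTransforms.mul {γ₁ γ₂ : SL2Z} (h₁ : ThetaTransforms γ₁) (h₂ : ThetaTransforms γ₂) :
    ThetaTransforms (γ₁ * γ₂) := by
  obtain ⟨J₁, hJ₁, ⟨C₁, hC₁⟩, H₁⟩ := h₁
  obtain ⟨J₂, hJ₂, ⟨C₂, hC₂⟩, H₂⟩ := h₂
  refine ⟨fun z ↦ J₁ (γ₂ • z) * J₂ z, ?_, ⟨C₁ * C₂, fun z ↦ ?_⟩, fun u z ↦ ?_⟩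
  · exact (hJ₁.comp (continuous_SL2Z_smul γ₂)).mul hJ₂
  · rw [mul_pow, hC₁, hC₂, sldenom_mul]
    ring
  · have h1 := sldenom_ne_zero γ₁ (γ₂ • z)
    have h2 := sldenom_ne_zero γ₂ z
    have key : ((γ₁ 1 0 : ℤ) : ℂ) + ((γ₂ 1 0 : ℤ) : ℂ) * (sldenom γ₁ (γ₂ • z) * sldenom γ₂ z) =
        (((γ₁ * γ₂) 1 0 : ℤ) : ℂ) * sldenom γ₂ z := by
      rw [← sldenom_mul]
      have hdet : ((γ₂ 0 0 : ℤ) : ℂ) * ((γ₂ 1 1 : ℤ) : ℂ) -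
          ((γ₂ 0 1 : ℤ) : ℂ) * ((γ₂ 1 0 : ℤ) : ℂ) = 1 := by exact_mod_cast SL2Z_det γ₂
      simp only [sldenom, Matrix.SpecialLinearGroup.coe_mul, Matrix.mul_apply, Fin.sum_univ_two]
      push_cast
      linear_combination (-((γ₁ 1 0 : ℤ) : ℂ)) * hdet
    rw [mul_smul, sldenom_mul, mul_comm (sldenom γ₁ _), ← div_div, H₁, H₂]
    rw [show J₁ (γ₂ • z) * J₂ z *
          cexp (π * Complex.I * (((γ₁ * γ₂) 1 0 : ℤ) : ℂ) * u ^ 2 /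
            (2 * (sldenom γ₂ z * sldenom γ₁ (γ₂ • z)))) =
        J₁ (γ₂ • z) * cexp (π * Complex.I * ((γ₁ 1 0 : ℤ) : ℂ) * (u / sldenom γ₂ z) ^ 2 /
            (2 * sldenom γ₁ (γ₂ • z))) *
          (J₂ z * cexp (π * Complex.I * ((γ₂ 1 0 : ℤ) : ℂ) * u ^ 2 / (2 * sldenom γ₂ z))) by
      rw [mul_mul_mul_comm, ← Complex.exp_add]
      congr 2
      field_simp
      linear_combination (-u ^ 2) * key]
    ring

lemma jacobiTheta₂_add_right_two_mul_int (u τ : ℂ) (n : ℤ) :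
    jacobiTheta₂ u (τ + 2 * n) = jacobiTheta₂ u τ := by
  have h : Function.Periodic (jacobiTheta₂ u) 2 := jacobiTheta₂_add_right u
  simpa [mul_comm] using h.int_mul n τ

lemma jacobiTheta₂_add_left_int (u τ : ℂ) (n : ℤ) :
    jacobiTheta₂ (u + n) τ = jacobiTheta₂ u τ := by
  have h : Function.Periodic (fun u ↦ jacobiTheta₂ u τ) 1 := fun u ↦ jacobiTheta₂_add_left u τ
  simpa using h.int_mul n u

lemma thetaTransforms_of_lower_left_eq_zero {γ : SL2Z} (hc : γ 1 0 = 0) : ThetaTransforms γ := by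
  have hdet := SL2Z_det γ
  rw [hc, mul_zero, sub_zero] at hdet
  refine ⟨1, continuous_const, ⟨((γ 1 1 : ℤ) : ℂ), fun z ↦ ?_⟩, fun u z ↦ ?_⟩
  · rcases Int.eq_one_or_neg_one_of_mul_eq_one' hdet with ⟨_, hd⟩ | ⟨_, hd⟩ <;>
      simp [sldenom, hc, hd]
  · rw [coe_SL2Z_smul]
    rcases Int.eq_one_or_neg_one_of_mul_eq_one' hdet with ⟨ha, hd⟩ | ⟨ha, hd⟩
    · simp [sldenom, hc, hd, ha, mul_add, jacobiTheta₂_add_right_two_mul_int]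
    · have := jacobiTheta₂_add_right_two_mul_int u (2 * z) (-γ 0 1)
      simp [sldenom, hc, hd, ha, mul_add, div_neg]
      simpa [add_comm] using this

/-- The lower triangular matrix `(1 0; 4m 1)`. -/
def lowerFour (m : ℤ) : SL2Z := ⟨!![1, 0; 4 * m, 1], by simp [Matrix.det_fin_two]⟩

/-- The translation matrix `(1 n; 0 1)`. -/
def upperOne (n : ℤ) : SL2Z := ⟨!![1, n; 0, 1], by simp [Matrix.det_fin_two]⟩

lemma upperOne_mul_neg (n : ℤ) : upperOne n * upperOne (-n) = 1 := by
  ext i j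
  fin_cases i <;> fin_cases j <;>
    simp only [Matrix.SpecialLinearGroup.coe_mul, Matrix.mul_apply, Fin.sum_univ_two] <;>
    simp [upperOne]

lemma lowerFour_mul_neg (n : ℤ) : lowerFour n * lowerFour (-n) = 1 := by
  ext i j
  fin_cases i <;> fin_cases j <;>
    simp only [Matrix.SpecialLinearGroup.coe_mul, Matrix.mul_apply, Fin.sum_univ_two] <;>
    simp [lowerFour]

lemma neg_I_mul_mem_slitPlane (z : ℍ) : -Complex.I * (2 * z) ∈ Complex.slitPlane := by
  left
  simp [z.im_pos]

lemma thetaTransforms_lowerFour (m : ℤ) : ThetaTransforms (lowerFour m) := by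
  have hcont : Continuous fun z : ℍ ↦ (-Complex.I * (2 * (z : ℂ))) ^ (1 / 2 : ℂ) :=
    Continuous.cpow (by fun_prop) continuous_const neg_I_mul_mem_slitPlane
  have hne (z : ℍ) : -Complex.I * (2 * (z : ℂ)) ≠ 0 :=
    Complex.slitPlane_ne_zero (neg_I_mul_mem_slitPlane z)
  have hne' (z : ℍ) : (-Complex.I * (2 * (z : ℂ))) ^ (1 / 2 : ℂ) ≠ 0 := by
    simp [Complex.cpow_eq_zero_iff, z.ne_zero]
  have hsq (z : ℍ) : ((-Complex.I * (2 * (z : ℂ))) ^ (1 / 2 : ℂ)) ^ 2 = -Complex.I * (2 * z) := by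
    rw [one_div]
    exact Complex.cpow_nat_inv_pow _ two_ne_zero
  have hj (z : ℍ) : sldenom (lowerFour m) z = 4 * m * z + 1 := by
    simp [sldenom, lowerFour]
  have hsm (z : ℍ) : ((lowerFour m • z : ℍ) : ℂ) = z / sldenom (lowerFour m) z := by
    rw [coe_SL2Z_smul]
    simp [lowerFour]
  refine ⟨fun z ↦ (-Complex.I * (2 * (z : ℂ))) ^ (1 / 2 : ℂ) /
    (-Complex.I * (2 * ((lowerFour m • z : ℍ) : ℂ))) ^ (1 / 2 : ℂ), ?_, ⟨1, fun z ↦ ?_⟩,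
    fun u z ↦ ?_⟩
  · exact hcont.div (hcont.comp (continuous_SL2Z_smul (lowerFour m))) fun z ↦ hne' _
  · have h0 := z.ne_zero
    have h1 := sldenom_ne_zero (lowerFour m) z
    rw [div_pow, hsq, hsq, hsm]
    field_simp
  · have h0 := z.ne_zero
    have h1 := sldenom_ne_zero (lowerFour m) z
    have e1 : u / sldenom (lowerFour m) z / (2 * (lowerFour m • z : ℍ)) = u / (2 * z) := by
      rw [hsm]
      field_simp
    have e2 : -1 / (2 * ((lowerFour m • z : ℍ) : ℂ)) = -1 / (2 * z) + 2 * ((-m : ℤ) : ℂ) := by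
      rw [hsm, hj]
      push_cast
      field_simp
      ring
    rw [jacobiTheta₂_functional_equation (u / _), jacobiTheta₂_functional_equation u, e1, e2,
      jacobiTheta₂_add_right_two_mul_int]
    have e3 : cexp (-π * Complex.I * (u / sldenom (lowerFour m) z) ^ 2 /
          (2 * (lowerFour m • z : ℍ))) =
        cexp (π * Complex.I * (((lowerFour m) 1 0 : ℤ) : ℂ) * u ^ 2 /
          (2 * sldenom (lowerFour m) z)) * cexp (-π * Complex.I * u ^ 2 / (2 * z)) := by
      rw [← Complex.exp_add, hsm]
      congr 1
      have : (((lowerFour m) 1 0 : ℤ) : ℂ) * z = sldenom (lowerFour m) z - 1 := by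
        rw [hj]
        simp [lowerFour]
      field_simp
      linear_combination (-u ^ 2) * this
    rw [e3]
    have := hne' z
    field_simp

lemma Int.exists_two_mul_abs_add_mul_le (x : ℤ) {y : ℤ} (hy : y ≠ 0) :
    ∃ n : ℤ, 2 * |x + n * y| ≤ |y| := by
  have h0 := Int.emod_nonneg x hy
  have h1 := Int.emod_lt_abs x hy
  have h2 := Int.emod_add_mul_ediv x y
  by_cases h : 2 * (x % y) ≤ |y|
  · refine ⟨-(x / y), ?_⟩
    rw [show x + -(x / y) * y = x % y by linarith, abs_of_nonneg h0]
    exact h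
  · refine ⟨-(x / y) - y.sign, ?_⟩
    rw [show x + (-(x / y) - y.sign) * y = x % y - |y| by
      rw [sub_mul, Int.sign_mul_self_eq_abs]; linarith, abs_of_nonpos (by linarith)]
    linarith

lemma thetaTransforms_of_four_dvd (γ : SL2Z) (hγ : (4 : ℤ) ∣ γ 1 0) : ThetaTransforms γ := by
  induction hn : (γ 1 0).natAbs using Nat.strong_induction_on generalizing γ with
  | _ n ih =>
    by_cases hc : γ 1 0 = 0
    · exact thetaTransforms_of_lower_left_eq_zero hc
    obtain ⟨k, hk⟩ := Int.exists_two_mul_abs_add_mul_le (γ 1 1) hc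
    set d := γ 1 1 + k * γ 1 0 with hd
    have hdet := SL2Z_det γ
    have hd_odd : d % 2 = 1 := by
      obtain ⟨e, he⟩ := hγ
      have : Odd (γ 0 0 * γ 1 1) := ⟨2 * (γ 0 1 * e), by rw [he] at hdet; linarith⟩
      have := (Int.odd_mul.mp this).2
      rw [← Int.odd_iff, hd, he]
      exact this.add_even ⟨2 * k * e, by ring⟩
    obtain ⟨m, hm⟩ := Int.exists_two_mul_abs_add_mul_le (γ 1 0) (show 4 * d ≠ 0 by omega)
    have hentry : (γ * upperOne k * lowerFour m) 1 0 = γ 1 0 + m * (4 * d) := by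
      simp only [Matrix.SpecialLinearGroup.coe_mul, Matrix.mul_apply, Fin.sum_univ_two]
      simp [upperOne, lowerFour, hd]
      ring
    have hdec : γ = γ * upperOne k * lowerFour m * (lowerFour (-m) * upperOne (-k)) := by
      rw [mul_assoc, ← mul_assoc (lowerFour m), lowerFour_mul_neg, one_mul, mul_assoc,
        upperOne_mul_neg, mul_one]
    rw [hdec]
    refine (ih _ ?_ _ ?_ rfl).mul ((thetaTransforms_lowerFour _).mul
      (thetaTransforms_of_lower_left_eq_zero (by simp [upperOne])))
    · rw [hentry]
      grind
    · rw [hentry]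
      exact hγ.add ⟨m * d, by ring⟩
lemma sldenom_cpow_half_sq (γ : SL2Z) (z : ℍ) :
    (sldenom γ z ^ ((1 : ℂ) / 2)) ^ 2 = sldenom γ z := by
  rw [one_div]
  exact Complex.cpow_nat_inv_pow _ two_ne_zero

lemma sldenom_cpow_ne_zero (γ : SL2Z) (z : ℍ) (s : ℂ) : sldenom γ z ^ s ≠ 0 := by
  simp [Complex.cpow_eq_zero_iff, sldenom_ne_zero]

/-- The automorphy factor of the theta function is a constant times the principal branch
of `(cz + d)^{1/2}`. -/
lemma ThetaTransforms.exists_multiplier {γ : SL2Z} (h : ThetaTransforms γ) :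
    ∃ ν : ℂ, ∀ (u : ℂ) (z : ℍ), jacobiTheta₂ (u / sldenom γ z) (2 * (γ • z : ℍ)) =
      ν * sldenom γ z ^ ((1 : ℂ) / 2) *
        cexp (π * Complex.I * ((γ 1 0 : ℤ) : ℂ) * u ^ 2 / (2 * sldenom γ z)) *
        jacobiTheta₂ u (2 * z) := by
  obtain ⟨J, hJ, ⟨C, hC⟩, H⟩ := h
  suffices hν : ∃ ν : ℂ, ∀ z, J z = ν * sldenom γ z ^ ((1 : ℂ) / 2) by
    obtain ⟨ν, hν⟩ := hν
    exact ⟨ν, fun u z ↦ by rw [H, hν]⟩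
  obtain ⟨s, hs⟩ := IsAlgClosed.exists_eq_mul_self C
  by_cases hs0 : s = 0
  · refine ⟨0, fun z ↦ ?_⟩
    simpa [hs, hs0] using hC z
  have hsq : Set.EqOn (J ^ 2) ((fun z ↦ s * sldenom γ z ^ ((1 : ℂ) / 2)) ^ 2) Set.univ := by
    intro z _
    simp only [Pi.pow_apply, mul_pow, hC, sldenom_cpow_half_sq, hs]
    ring
  rcases isPreconnected_univ.eq_or_eq_neg_of_sq_eq hJ.continuousOn
    (continuous_const.mul (continuous_sldenom_cpow γ _)).continuousOn hsq
    (fun _ ↦ mul_ne_zero hs0 (sldenom_cpow_ne_zero _ _ _)) with h | h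
  · exact ⟨s, fun z ↦ h (Set.mem_univ z)⟩
  · exact ⟨-s, fun z ↦ by simpa using h (Set.mem_univ z)⟩

lemma theta_eq_jacobiTheta₂ (z : ℍ) : theta z = jacobiTheta₂ 0 (2 * z) := by
  refine tsum_congr fun n ↦ ?_
  rw [jacobiTheta₂_term]
  congr 1
  ring

lemma theta_I_ne_zero : theta UpperHalfPlane.I ≠ 0 := by
  have hterm (n : ℤ) : cexp (2 * Real.pi * Complex.I * (n : ℂ) ^ 2 * (UpperHalfPlane.I : ℍ)) =
      ((Real.exp (-(2 * Real.pi * n ^ 2)) : ℝ) : ℂ) := by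
    rw [UpperHalfPlane.coe_I, Complex.ofReal_exp]
    congr 1
    push_cast
    linear_combination (2 * Real.pi * (n : ℂ) ^ 2) * Complex.I_mul_I
  have hsum : Summable fun n : ℤ ↦ ((Real.exp (-(2 * Real.pi * n ^ 2)) : ℝ) : ℂ) := by
    have := (summable_jacobiTheta₂_term_iff 0 (2 * (UpperHalfPlane.I : ℍ))).mpr
      (by simp)
    refine this.congr fun n ↦ ?_
    rw [← hterm, jacobiTheta₂_term]
    congr 1
    ring
  rw [theta, tsum_congr hterm, ← Complex.ofReal_tsum, Complex.ofReal_ne_zero]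
  exact (Summable.tsum_pos (by exact_mod_cast hsum) (fun _ ↦ (Real.exp_pos _).le) 0
    (Real.exp_pos _)).ne'

lemma nuTheta_eq_of_jacobiTheta₂ {γ : SL2Z} {ν : ℂ}
    (h : ∀ (u : ℂ) (z : ℍ), jacobiTheta₂ (u / sldenom γ z) (2 * (γ • z : ℍ)) =
      ν * sldenom γ z ^ ((1 : ℂ) / 2) *
        cexp (π * Complex.I * ((γ 1 0 : ℤ) : ℂ) * u ^ 2 / (2 * sldenom γ z)) *
        jacobiTheta₂ u (2 * z)) : nuTheta γ = ν := by
  have h0 := h 0 UpperHalfPlane.I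
  simp only [zero_div, ne_eq, OfNat.ofNat_ne_zero, not_false_eq_true, zero_pow, mul_zero,
    Complex.exp_zero, mul_one, ← theta_eq_jacobiTheta₂] at h0
  rw [nuTheta, h0]
  have h1 := theta_I_ne_zero
  have h2 := sldenom_cpow_ne_zero γ UpperHalfPlane.I ((1 : ℂ) / 2)
  field_simp

lemma jacobiTheta₂_add_int_mul (u τ : ℂ) (n : ℤ) :
    jacobiTheta₂ (u + n * τ) τ = cexp (-π * Complex.I * (n ^ 2 * τ + 2 * n * u)) *
      jacobiTheta₂ u τ := by
  conv_rhs => rw [jacobiTheta₂, ← tsum_mul_left, ← (Equiv.addRight n).tsum_eq]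
  refine tsum_congr fun m ↦ ?_
  simp_rw [jacobiTheta₂_term, ← Complex.exp_add, Equiv.coe_addRight, Int.cast_add]
  ring_nf

/-- Theta values at `12`-torsion points are permuted by `Γ₀(576)`. -/
lemma jacobiTheta₂_torsion_smul {γ : SL2Z} (hγ : (576 : ℤ) ∣ γ 1 0) (j : ℤ) (z : ℍ) :
    jacobiTheta₂ (j / 12) (2 * (γ • z : ℍ)) = nuTheta γ * sldenom γ z ^ ((1 : ℂ) / 2) *
      jacobiTheta₂ ((j * γ 1 1 : ℤ) / 12) (2 * z) := by
  obtain ⟨ν, hν⟩ := (thetaTransforms_of_four_dvd γ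
    (dvd_trans (by norm_num) hγ)).exists_multiplier
  rw [nuTheta_eq_of_jacobiTheta₂ hν]
  obtain ⟨e, he⟩ := hγ
  have h0 := sldenom_ne_zero γ z
  have h := hν (j / 12 * sldenom γ z) z
  rw [mul_div_cancel_right₀ _ h0] at h
  rw [h, mul_assoc]
  congr 1
  rw [show (j : ℂ) / 12 * sldenom γ z =
      ((j * γ 1 1 : ℤ) / 12 : ℂ) + ((24 * j * e : ℤ) : ℂ) * (2 * z) by
    simp only [sldenom, he]
    push_cast
    ring, jacobiTheta₂_add_int_mul, ← mul_assoc, ← Complex.exp_add]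
  convert one_mul _
  rw [show π * Complex.I * ((γ 1 0 : ℤ) : ℂ) *
      (((j * γ 1 1 : ℤ) / 12 : ℂ) + ((24 * j * e : ℤ) : ℂ) * (2 * z)) ^ 2 / (2 * sldenom γ z) =
      ((j ^ 2 * γ 1 1 * e : ℤ) : ℂ) * (2 * π * Complex.I) +
        π * Complex.I * (1152 * j ^ 2 * e ^ 2 * z) by
    field_simp
    simp only [sldenom, he]
    push_cast
    ring]
  rw [Complex.exp_eq_one_iff]
  exact ⟨-(j ^ 2 * γ 1 1 * e), by push_cast; ring⟩

lemma norm_prod_one_sub_pow_le {q : ℂ} (hq : ‖q‖ < 1) (k n : ℕ) :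
    ‖∏ i ∈ Finset.range n, (1 - q ^ (k + i + 1))‖ ≤ Real.exp (1 - ‖q‖)⁻¹ := by
  calc ‖∏ i ∈ Finset.range n, (1 - q ^ (k + i + 1))‖
      = ∏ i ∈ Finset.range n, ‖1 - q ^ (k + i + 1)‖ := norm_prod _ _
    _ ≤ ∏ i ∈ Finset.range n, Real.exp (‖q‖ ^ i) := by
        refine Finset.prod_le_prod (fun _ _ ↦ norm_nonneg _) fun i _ ↦ ?_
        calc ‖1 - q ^ (k + i + 1)‖ ≤ ‖(1 : ℂ)‖ + ‖q ^ (k + i + 1)‖ := norm_sub_le _ _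
          _ ≤ ‖q‖ ^ i + 1 := by
            rw [norm_one, norm_pow, add_comm]
            gcongr 1
            exact pow_le_pow_of_le_one (norm_nonneg _) hq.le (by omega)
          _ ≤ _ := Real.add_one_le_exp _
    _ = Real.exp (∑ i ∈ Finset.range n, ‖q‖ ^ i) := (Real.exp_sum _ _).symm
    _ ≤ _ := by
        gcongr
        rw [← tsum_geometric_of_lt_one (norm_nonneg _) hq]
        exact (summable_geometric_of_lt_one (norm_nonneg _) hq).sum_le_tsum _
          fun _ _ ↦ by positivity

/-- **Pentagonal number theorem** on the open unit disc. -/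
theorem tprod_one_sub_pow_eq_tsum_pentagonal {q : ℂ} (hq : ‖q‖ < 1) :
    ∏' n : ℕ, (1 - q ^ (n + 1)) =
      ∑' k : ℕ, (-1) ^ k * (q ^ pentagonal (-k) - q ^ pentagonal (k + 1)) := by
  have hgeom := summable_geometric_of_lt_one (norm_nonneg q) hq
  have hbound (k n : ℕ) : ‖q ^ ((k + 1) * n) * ∏ i ∈ Finset.range (n + 1), (1 - q ^ (k + i + 1))‖ ≤
      ‖q‖ ^ n * Real.exp (1 - ‖q‖)⁻¹ := by
    rw [norm_mul, norm_pow]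
    exact mul_le_mul (pow_le_pow_of_le_one (norm_nonneg _) hq.le (by nlinarith))
      (norm_prod_one_sub_pow_le hq k _) (norm_nonneg _) (by positivity)
  have hpow {a b : ℕ} (h : a ≤ b) : ‖q ^ b‖ ≤ ‖q‖ ^ a := by
    rw [norm_pow]
    exact pow_le_pow_of_le_one (norm_nonneg _) hq.le h
  refine Pentagonal.tprod_one_sub_pow (tendsto_pow_atTop_nhds_zero_of_norm_lt_one hq)
    (fun k ↦ Summable.of_norm_bounded (hgeom.mul_right _) (hbound k)) (fun k ↦ ?_) ?_ ?_
  · have := (summable_nat_add_iff (k + 1)).mpr hgeom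
    simp_rw [sub_eq_add_neg]
    exact multipliable_one_add_of_summable (by simpa [add_assoc] using this)
  · refine Summable.of_norm_bounded (hgeom.add hgeom) fun k ↦ ?_
    rw [norm_mul, norm_pow, norm_neg, norm_one, one_pow, one_mul]
    refine (norm_sub_le _ _).trans (add_le_add (hpow ?_) (hpow ?_))
    · have := two_mul_natCast_pentagonal_neg k
      zify
      nlinarith
    · have := two_mul_natCast_pentagonal (k + 1)
      zify
      nlinarith
  · have hlim := (tendsto_pow_atTop_nhds_zero_of_lt_one (norm_nonneg q) hq).mul_const
      ((1 - ‖q‖)⁻¹ * Real.exp (1 - ‖q‖)⁻¹)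
    rw [zero_mul] at hlim
    refine squeeze_zero_norm (fun k ↦ ?_) hlim
    rw [norm_mul, norm_mul, norm_pow, norm_neg, norm_one, one_pow, one_mul]
    refine mul_le_mul (hpow ?_) ?_ (norm_nonneg _) (by positivity)
    · rw [Nat.le_div_iff_mul_le two_pos]
      nlinarith
    · exact tsum_of_norm_bounded
        ((hasSum_geometric_of_lt_one (norm_nonneg q) hq).mul_right _) (hbound k)

lemma coe_smul24 (z : ℍ) : (smul24 z : ℂ) = 24 * z := rfl

lemma summable_exp_sq (z : ℍ) :
    Summable fun n : ℤ ↦ cexp (2 * Real.pi * Complex.I * (n : ℂ) ^ 2 * z) := by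
  refine ((summable_jacobiTheta₂_term_iff 0 (2 * z)).mpr (by simp [z.im_pos])).congr fun n ↦ ?_
  rw [jacobiTheta₂_term]
  congr 1
  ring

lemma summable_negOnePow_exp_sq (z : ℍ) : Summable fun n : ℤ ↦
    (n.negOnePow : ℂ) * cexp (2 * Real.pi * Complex.I * ((6 * n + 1 : ℤ) : ℂ) ^ 2 * z) := by
  have hinj : Function.Injective fun n : ℤ ↦ 6 * n + 1 := fun a b h ↦ by simpa using h
  refine Summable.of_norm_bounded ((summable_exp_sq z).comp_injective hinj).norm fun n ↦ ?_
  rw [norm_mul]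
  rcases Int.even_or_odd n with h | h
  · simp [Int.negOnePow_even _ h]
  · simp [Int.negOnePow_odd _ h]

lemma tsum_int_eq_tsum_nat_add {F : ℤ → ℂ} (hF : Summable F) :
    ∑' n, F n = ∑' k : ℕ, (F k + F (-(k + 1))) := by
  have h₁ : Summable fun k : ℕ ↦ F k := hF.comp_injective Nat.cast_injective
  have h₂ : Summable fun k : ℕ ↦ F (-(k + 1)) :=
    hF.comp_injective (i := fun k : ℕ ↦ (-(k + 1) : ℤ)) fun a b h ↦ by simpa using h
  rw [tsum_of_nat_of_neg_add_one h₁ h₂, h₁.tsum_add h₂]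

lemma dedekindEta_eq_tsum_pentagonal (z : ℍ) : dedekindEta z =
    ∑' k : ℕ, cexp (Real.pi * Complex.I * (z : ℂ) / 12) * ((-1) ^ k *
      (cexp (2 * Real.pi * Complex.I * z) ^ pentagonal (-k) -
        cexp (2 * Real.pi * Complex.I * z) ^ pentagonal (k + 1))) := by
  rw [tsum_mul_left, ← tprod_one_sub_pow_eq_tsum_pentagonal
    (by simpa using UpperHalfPlane.norm_exp_two_pi_I_lt_one z), dedekindEta]
  congr 1
  refine tprod_congr fun n ↦ ?_
  rw [← Complex.exp_nat_mul]
  congr 2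
  push_cast
  ring

lemma dedekindEta_smul24 (z : ℍ) : dedekindEta (smul24 z) = ∑' n : ℤ,
    (n.negOnePow : ℂ) * cexp (2 * Real.pi * Complex.I * ((6 * n + 1 : ℤ) : ℂ) ^ 2 * z) := by
  rw [tsum_int_eq_tsum_nat_add (summable_negOnePow_exp_sq z), dedekindEta_eq_tsum_pentagonal]
  refine tsum_congr fun k ↦ ?_
  have h₁ : (2 * (pentagonal (-k) : ℕ) : ℂ) = k * (3 * k + 1) := by
    have := congrArg (Int.cast : ℤ → ℂ) (two_mul_natCast_pentagonal_neg k)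
    push_cast at this
    linear_combination this
  have h₂ : (2 * (pentagonal (k + 1) : ℕ) : ℂ) = (k + 1) * (3 * (k + 1) - 1) := by
    have := congrArg (Int.cast : ℤ → ℂ) (two_mul_natCast_pentagonal (k + 1))
    push_cast at this
    linear_combination this
  have hsign₁ : (((k : ℤ).negOnePow : ℤ) : ℂ) = (-1) ^ k := by simp [Int.negOnePow_def]
  have hsign₂ : (((-(k + 1) : ℤ).negOnePow : ℤ) : ℂ) = -(-1) ^ k := by
    rw [Int.negOnePow_neg, Int.negOnePow_succ]
    simp [Int.negOnePow_def]
  rw [hsign₁, hsign₂, mul_left_comm, mul_sub, ← Complex.exp_nat_mul, ← Complex.exp_nat_mul,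
    ← Complex.exp_add, ← Complex.exp_add, neg_mul, ← sub_eq_add_neg, ← mul_sub]
  congr 3
  · rw [coe_smul24]
    push_cast
    linear_combination (24 * Real.pi * Complex.I * z) * h₁
  · rw [coe_smul24]
    push_cast
    linear_combination (24 * Real.pi * Complex.I * z) * h₂

/-- The weight `1/2` theta function attached to the character `(12/•)`, up to a scalar. -/
def thetaTwelve (z : ℍ) : ℂ := jacobiTheta₂ (1 / 12) (2 * z) - jacobiTheta₂ (5 / 12) (2 * z)

lemma kron12_six_mul_add_one (n : ℤ) : kron12 (6 * n + 1) = (n.negOnePow : ℤ) := by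
  rcases Int.even_or_odd n with h | h
  · rw [Int.negOnePow_even _ h, Units.val_one, kron12]
    grind
  · rw [Int.negOnePow_odd _ h, Units.val_neg, Units.val_one, kron12]
    grind

lemma hasSum_kron12_exp_sq (z : ℍ) : HasSum
    (fun n : ℤ ↦ (kron12 n : ℂ) * cexp (2 * Real.pi * Complex.I * (n : ℂ) ^ 2 * z))
    (2 * dedekindEta (smul24 z)) := by
  have hinj : Function.Injective fun n : ℤ ↦ 6 * n + 1 := fun a b h ↦ by simpa using h
  have h : HasSum (fun n : ℤ ↦ if n % 6 = 1 then
      (kron12 n : ℂ) * cexp (2 * Real.pi * Complex.I * (n : ℂ) ^ 2 * z) else 0)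
      (dedekindEta (smul24 z)) := by
    rw [dedekindEta_smul24, ← hinj.hasSum_iff]
    · convert (summable_negOnePow_exp_sq z).hasSum using 2 with n
      simp only [Function.comp_apply]
      rw [if_pos (by omega), kron12_six_mul_add_one]
    · intro n hn
      rw [if_neg]
      exact fun h ↦ hn ⟨n / 6, by simp only; omega⟩
  rw [two_mul (dedekindEta _)]
  convert h.add ((Equiv.neg ℤ).hasSum_iff.mpr h) using 2 with n
  simp only [Function.comp_apply, Equiv.neg_apply, Int.cast_neg, neg_sq]
  have hneg : kron12 (-n) = kron12 n := by
    simp only [kron12]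
    grind
  rw [hneg]
  by_cases h1 : n % 6 = 1
  · rw [if_pos h1, if_neg (by omega), add_zero]
  · by_cases h5 : n % 6 = 5
    · rw [if_neg h1, if_pos (by omega), zero_add]
    · rw [if_neg h1, if_neg (by omega), show kron12 n = 0 by simp only [kron12]; grind]
      simp

lemma gaussSum_twelve {ζ : ℂ} (hζ : ζ ^ 4 = ζ ^ 2 - 1) (n : ℤ) :
    ζ ^ n - ζ ^ (5 * n) + (ζ ^ (-n) - ζ ^ (5 * -n)) =
      2 * ζ * (2 - ζ ^ 2) * kron12 n := by
  have h6 : ζ ^ 6 = -1 := by linear_combination (ζ ^ 2 + 1) * hζ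
  have h12 : ζ ^ 12 = 1 := by linear_combination (ζ ^ 6 - 1) * h6
  have h0 : ζ ≠ 0 := by
    rintro rfl
    norm_num at hζ
  have hred (m : ℤ) : ζ ^ m = ζ ^ (m % 12).toNat := by
    rw [← zpow_natCast, Int.toNat_of_nonneg (Int.emod_nonneg _ (by norm_num))]
    conv_lhs => rw [← Int.emod_add_mul_ediv m 12, zpow_add₀ h0, _root_.zpow_mul]
    rw [show ζ ^ (12 : ℤ) = 1 by exact_mod_cast h12, _root_.one_zpow, mul_one]
  rw [hred n, hred (5 * n), hred (-n), hred (5 * -n)]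
  have hn := Int.emod_nonneg n (show (12 : ℤ) ≠ 0 by norm_num)
  have hn' := Int.emod_lt_of_pos n (show (0 : ℤ) < 12 by norm_num)
  rw [Int.mul_emod 5, Int.mul_emod 5 (-n), ← Int.emod_emod_of_dvd (-n) (dvd_refl 12),
    show -n % 12 = (-(n % 12)) % 12 by omega, kron12]
  generalize n % 12 = r at *
  interval_cases r <;> norm_num <;> grind

lemma exists_ne_zero_thetaTwelve_eq : ∃ K : ℂ, K ≠ 0 ∧
    ∀ z, thetaTwelve z = K * dedekindEta (smul24 z) := by
  set ζ : ℂ := cexp (2 * Real.pi * Complex.I / 12) with hζdef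
  have hprim : IsPrimitiveRoot ζ 12 := by
    simpa using Complex.isPrimitiveRoot_exp 12 (by norm_num)
  have h12 := hprim.pow_eq_one
  have h6 : ζ ^ 6 = -1 := by
    have h := hprim.pow_ne_one_of_pos_of_lt (l := 6) (by norm_num) (by norm_num)
    have : (ζ ^ 6 - 1) * (ζ ^ 6 + 1) = 0 := by linear_combination h12
    exact eq_neg_of_add_eq_zero_left
      ((mul_eq_zero.mp this).resolve_left (sub_ne_zero.mpr h))
  have h4 : ζ ^ 4 = ζ ^ 2 - 1 := by
    have h := hprim.pow_ne_one_of_pos_of_lt (l := 4) (by norm_num) (by norm_num)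
    have hne : ζ ^ 2 + 1 ≠ 0 := fun h2 ↦ h (by linear_combination (ζ ^ 2 - 1) * h2)
    have : (ζ ^ 2 + 1) * (ζ ^ 4 - (ζ ^ 2 - 1)) = 0 := by linear_combination h6
    exact sub_eq_zero.mp ((mul_eq_zero.mp this).resolve_left hne)
  have hne : 2 - ζ ^ 2 ≠ 0 := fun h ↦ by
    have h2 : ζ ^ 2 = 2 := (sub_eq_zero.mp h).symm
    have : ζ ^ 4 = 4 := by linear_combination (ζ ^ 2 + 2) * h2
    rw [this, h2] at h4
    norm_num at h4
  refine ⟨2 * ζ * (2 - ζ ^ 2), mul_ne_zero (mul_ne_zero two_ne_zero (Complex.exp_ne_zero _)) hne,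
    fun z ↦ ?_⟩
  have him : 0 < (2 * (z : ℂ)).im := by simp [z.im_pos]
  have hterm (j : ℕ) (n : ℤ) : jacobiTheta₂_term n (j / 12) (2 * z) =
      ζ ^ (j * n) * cexp (2 * Real.pi * Complex.I * (n : ℂ) ^ 2 * z) := by
    rw [jacobiTheta₂_term, hζdef, ← Complex.exp_int_mul, ← Complex.exp_add]
    congr 1
    push_cast
    ring
  have h : HasSum (fun n : ℤ ↦ (ζ ^ n - ζ ^ (5 * n)) *
      cexp (2 * Real.pi * Complex.I * (n : ℂ) ^ 2 * z)) (thetaTwelve z) := by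
    have hsub := (hasSum_jacobiTheta₂_term (1 / 12) him).sub
      (hasSum_jacobiTheta₂_term (5 / 12) him)
    have heq (n : ℤ) : (ζ ^ n - ζ ^ (5 * n)) * cexp (2 * Real.pi * Complex.I * (n : ℂ) ^ 2 * z) =
        jacobiTheta₂_term n (1 / 12) (2 * z) - jacobiTheta₂_term n (5 / 12) (2 * z) := by
      have h1 := hterm 1 n
      have h5 := hterm 5 n
      push_cast at h1 h5
      rw [h1, h5, one_mul, sub_mul]
    rwa [funext heq]
  have h' := h.add ((Equiv.neg ℤ).hasSum_iff.mpr h)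
  have hsum := (hasSum_kron12_exp_sq z).mul_left (2 * ζ * (2 - ζ ^ 2))
  have heq (n : ℤ) :
      (ζ ^ n - ζ ^ (5 * n)) * cexp (2 * Real.pi * Complex.I * (n : ℂ) ^ 2 * z) +
        ((fun n : ℤ ↦ (ζ ^ n - ζ ^ (5 * n)) *
          cexp (2 * Real.pi * Complex.I * (n : ℂ) ^ 2 * z)) ∘ Equiv.neg ℤ) n =
      2 * ζ * (2 - ζ ^ 2) *
        ((kron12 n : ℂ) * cexp (2 * Real.pi * Complex.I * (n : ℂ) ^ 2 * z)) := by
    simp only [Function.comp_apply, Equiv.neg_apply, Int.cast_neg, neg_sq]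
    rw [← add_mul, gaussSum_twelve h4, mul_assoc]
  rw [funext heq] at h'
  linear_combination h'.unique hsum / 2

lemma emod_twelve_of_twelve_dvd {γ : SL2Z} (hγ : (12 : ℤ) ∣ γ 1 0) :
    γ 1 1 % 12 = 1 ∨ γ 1 1 % 12 = 5 ∨ γ 1 1 % 12 = 7 ∨ γ 1 1 % 12 = 11 := by
  obtain ⟨c, hc⟩ := hγ
  have hdet : γ 0 0 * γ 1 1 % 12 = 1 := by
    have h := SL2Z_det γ
    rw [hc, mul_left_comm] at h
    omega
  rw [Int.mul_emod] at hdet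
  have h₁ := Int.emod_nonneg (γ 0 0) (show (12 : ℤ) ≠ 0 by norm_num)
  have h₂ := Int.emod_lt_of_pos (γ 0 0) (show (0 : ℤ) < 12 by norm_num)
  have h₃ := Int.emod_nonneg (γ 1 1) (show (12 : ℤ) ≠ 0 by norm_num)
  have h₄ := Int.emod_lt_of_pos (γ 1 1) (show (0 : ℤ) < 12 by norm_num)
  generalize γ 0 0 % 12 = a at *
  generalize γ 1 1 % 12 = d at *
  interval_cases d <;> omega

lemma jacobiTheta₂_div_twelve_congr {m n : ℤ} (τ : ℂ) (h : m % 12 = n % 12 ∨ m % 12 = (-n) % 12) :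
    jacobiTheta₂ (m / 12) τ = jacobiTheta₂ (n / 12) τ := by
  have hper {k : ℤ} (h : m % 12 = k % 12) :
      jacobiTheta₂ (m / 12) τ = jacobiTheta₂ (k / 12) τ := by
    obtain ⟨q, rfl⟩ : ∃ q, m = k + 12 * q := ⟨m / 12 - k / 12, by omega⟩
    rw [← jacobiTheta₂_add_left_int (k / 12) τ q]
    congr 1
    push_cast
    ring
  rcases h with h | h
  · exact hper h
  · rw [hper h, Int.cast_neg, neg_div, jacobiTheta₂_neg_left]

lemma jacobiTheta₂_sub_eq_kron12_mul {d : ℤ} (τ : ℂ)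
    (hd : d % 12 = 1 ∨ d % 12 = 5 ∨ d % 12 = 7 ∨ d % 12 = 11) :
    jacobiTheta₂ ((1 * d : ℤ) / 12) τ - jacobiTheta₂ ((5 * d : ℤ) / 12) τ =
      kron12 d * (jacobiTheta₂ ((1 : ℤ) / 12) τ - jacobiTheta₂ ((5 : ℤ) / 12) τ) := by
  have h (m n : ℤ) := jacobiTheta₂_div_twelve_congr (m := m) (n := n) τ
  rcases hd with hd | hd | hd | hd
  · rw [h (1 * d) 1 (by omega), h (5 * d) 5 (by omega), kron12, if_pos (by omega)]
    simp
  · rw [h (1 * d) 5 (by omega), h (5 * d) 1 (by omega), kron12, if_neg (by omega),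
      if_pos (by omega)]
    push_cast
    ring
  · rw [h (1 * d) 5 (by omega), h (5 * d) 1 (by omega), kron12, if_neg (by omega),
      if_pos (by omega)]
    push_cast
    ring
  · rw [h (1 * d) 1 (by omega), h (5 * d) 5 (by omega), kron12, if_pos (by omega)]
    simp

theorem thetaTwelve_smul {γ : SL2Z} (hγ : (576 : ℤ) ∣ γ 1 0) (z : ℍ) :
    thetaTwelve (γ • z) =
      kron12 (γ 1 1) * nuTheta γ * sldenom γ z ^ ((1 : ℂ) / 2) * thetaTwelve z := by
  have h₁ := jacobiTheta₂_torsion_smul hγ 1 z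
  have h₅ := jacobiTheta₂_torsion_smul hγ 5 z
  have h := jacobiTheta₂_sub_eq_kron12_mul (2 * (z : ℂ))
    (emod_twelve_of_twelve_dvd ((show (12 : ℤ) ∣ 576 by norm_num).trans hγ))
  simp only [Int.cast_one, Int.cast_ofNat] at h h₁ h₅
  rw [thetaTwelve, h₁, h₅, ← mul_sub, h, thetaTwelve]
  ring

lemma dedekindEta_ne_zero (z : ℍ) : dedekindEta z ≠ 0 := by
  refine mul_ne_zero (Complex.exp_ne_zero _) ?_
  simpa only [ModularForm.eta_q_eq_cexp] using ModularForm.eta_tprod_ne_zero z.2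

/-- The conjugate of `γ` by `z ↦ 24 z`, for `γ` with lower left entry divisible by `24`. -/
def conj24 (γ : SL2Z) (hγ : (24 : ℤ) ∣ γ 1 0) : SL2Z :=
  ⟨!![γ 0 0, 24 * γ 0 1; γ 1 0 / 24, γ 1 1], by
    rw [Matrix.det_fin_two_of]
    linear_combination SL2Z_det γ - γ 0 1 * Int.mul_ediv_cancel' hγ⟩

lemma conj24_lower_left {γ : SL2Z} (hγ : (24 : ℤ) ∣ γ 1 0) :
    24 * (conj24 γ hγ) 1 0 = γ 1 0 := Int.mul_ediv_cancel' hγ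

lemma conj24_lower_right {γ : SL2Z} (hγ : (24 : ℤ) ∣ γ 1 0) : (conj24 γ hγ) 1 1 = γ 1 1 := rfl

lemma sldenom_conj24 {γ : SL2Z} (hγ : (24 : ℤ) ∣ γ 1 0) (z : ℍ) :
    sldenom (conj24 γ hγ) (smul24 z) = sldenom γ z := by
  rw [sldenom, sldenom, coe_smul24, conj24_lower_right, ← conj24_lower_left hγ]
  push_cast
  ring

lemma smul24_smul {γ : SL2Z} (hγ : (24 : ℤ) ∣ γ 1 0) (z : ℍ) :
    smul24 (γ • z) = conj24 γ hγ • smul24 z := by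
  refine UpperHalfPlane.ext ?_
  rw [coe_smul24, coe_SL2Z_smul, coe_SL2Z_smul, sldenom_conj24, coe_smul24, ← mul_div_assoc]
  congr 1
  simp only [conj24, Matrix.SpecialLinearGroup.coe_mk, Matrix.of_apply, Matrix.cons_val',
    Matrix.cons_val_zero, Matrix.cons_val_one]
  push_cast
  ring

theorem nuEta_conj24 {γ : SL2Z} (hγ : (576 : ℤ) ∣ γ 1 0) (hγ' : (24 : ℤ) ∣ γ 1 0) :
    nuEta (conj24 γ hγ') = kron12 (γ 1 1) * nuTheta γ := by
  obtain ⟨K, hK, h⟩ := exists_ne_zero_thetaTwelve_eq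
  obtain ⟨z, hz⟩ : ∃ z, smul24 z = UpperHalfPlane.I :=
    ⟨⟨Complex.I / 24, by simp⟩, UpperHalfPlane.ext <| by
      rw [coe_smul24]
      exact mul_div_cancel₀ _ (by norm_num)⟩
  have key := thetaTwelve_smul hγ z
  rw [h, h, smul24_smul hγ', ← sldenom_conj24 hγ', hz] at key
  rw [nuEta, div_eq_iff (mul_ne_zero (sldenom_cpow_ne_zero _ _ _) (dedekindEta_ne_zero _))]
  refine mul_left_cancel₀ hK ?_
  rw [key]
  ring

lemma kron12_pow_of_odd (n : ℤ) {r : ℕ} (hr : Odd r) : kron12 n ^ r = kron12 n := by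
  rw [kron12]
  split_ifs
  · exact one_pow r
  · exact hr.neg_one_pow
  · exact zero_pow hr.pos.ne'

lemma mdifferentiable_comp_smul24 {f : ℍ → ℂ} (hf : MDifferentiable 𝓘(ℂ) 𝓘(ℂ) f) :
    MDifferentiable 𝓘(ℂ) 𝓘(ℂ) fun z ↦ f (smul24 z) := by
  rw [UpperHalfPlane.mdifferentiable_iff] at hf ⊢
  refine (hf.comp (differentiable_id.const_mul (24 : ℂ)).differentiableOn fun z hz ↦ ?_).congr
    fun z hz ↦ ?_
  · have : 0 < z.im := hz
    simpa
  · have h24 : 0 < (24 * z).im := by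
      have : 0 < z.im := hz
      simpa
    simp only [Function.comp_apply, id]
    rw [ofComplex_apply_of_im_pos hz, ofComplex_apply_of_im_pos h24]
    rfl

/-- Factorization of `diag(24, 1) γ` as a unimodular matrix times an upper triangular one. -/
lemma exists_smul24_factorization (γ : SL2Z) : ∃ (γ₁ : SL2Z) (A B D : ℤ), 0 < A ∧ 0 < D ∧
    24 * γ 0 0 = γ₁ 0 0 * A ∧ 24 * γ 0 1 = γ₁ 0 0 * B + γ₁ 0 1 * D ∧
    γ 1 0 = γ₁ 1 0 * A ∧ γ 1 1 = γ₁ 1 0 * B + γ₁ 1 1 * D := by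
  have hdet := SL2Z_det γ
  have hne : Int.gcd (24 * γ 0 0) (γ 1 0) ≠ 0 := fun h ↦ by
    obtain ⟨ha, hc⟩ := Int.gcd_eq_zero_iff.mp h
    rw [show γ 0 0 = 0 by omega, hc] at hdet
    simp at hdet
  obtain ⟨p, hp⟩ := Int.gcd_dvd_left (a := 24 * γ 0 0) (b := γ 1 0)
  obtain ⟨q, hq⟩ := Int.gcd_dvd_right (a := 24 * γ 0 0) (b := γ 1 0)
  have hbez := Int.gcd_eq_gcd_ab (24 * γ 0 0) (γ 1 0)
  set g : ℤ := ((Int.gcd (24 * γ 0 0) (γ 1 0) : ℕ) : ℤ)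
  have hg0 : 0 < g := by positivity
  set s := Int.gcdA (24 * γ 0 0) (γ 1 0)
  set t := Int.gcdB (24 * γ 0 0) (γ 1 0)
  have hst : p * s + q * t = 1 := by
    refine mul_left_cancel₀ hg0.ne' ?_
    linear_combination -hbez - s * hp - t * hq
  have hgD : g * (p * γ 1 1 - 24 * γ 0 1 * q) = 24 := by
    linear_combination 24 * hdet - γ 1 1 * hp + 24 * γ 0 1 * hq
  refine ⟨⟨!![p, -t; q, s], by rw [Matrix.det_fin_two_of]; linear_combination hst⟩,
    g, 24 * γ 0 1 * s + γ 1 1 * t, p * γ 1 1 - 24 * γ 0 1 * q, hg0,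
    pos_of_mul_pos_right (by rw [hgD]; norm_num) hg0.le, ?_, ?_, ?_, ?_⟩ <;>
  simp only [Matrix.of_apply, Matrix.cons_val', Matrix.cons_val_zero,
    Matrix.cons_val_one]
  · linear_combination hp
  · linear_combination -24 * γ 0 1 * hst
  · linear_combination hq
  · linear_combination -γ 1 1 * hst

lemma ofReal_mul_cpow {x : ℝ} (hx : 0 < x) {w : ℂ} (hw : w ≠ 0) (s : ℂ) :
    (x * w) ^ s = (x : ℂ) ^ s * w ^ s := by
  have hx' : (x : ℂ) ≠ 0 := by exact_mod_cast hx.ne'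
  rw [Complex.cpow_def_of_ne_zero (mul_ne_zero hx' hw), Complex.cpow_def_of_ne_zero hx',
    Complex.cpow_def_of_ne_zero hw, Complex.log_ofReal_mul hx hw, Complex.ofReal_log hx.le,
    add_mul, Complex.exp_add]

theorem isZeroAtImInfty_comp_smul24 {f : ℍ → ℂ} {s : ℂ}
    (hf : ∀ γ : SL2Z, IsZeroAtImInfty fun z ↦ sldenom γ z ^ s * f (γ • z)) (γ : SL2Z) :
    IsZeroAtImInfty fun z ↦ sldenom γ z ^ s * f (smul24 (γ • z)) := by
  obtain ⟨γ₁, A, B, D, hA, hD, h₁, h₂, h₃, h₄⟩ := exists_smul24_factorization γ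
  have hA' : (0 : ℝ) < A := by exact_mod_cast hA
  have hD' : (0 : ℝ) < D := by exact_mod_cast hD
  have hDne : (D : ℂ) ≠ 0 := by exact_mod_cast hD.ne'
  have him (z : ℍ) : ((A * z + B) / D : ℂ).im = A * z.im / D := by
    rw [show (D : ℂ) = ((D : ℝ) : ℂ) by simp, Complex.div_ofReal_im]
    simp
  let w (z : ℍ) : ℍ := ⟨(A * z + B) / D, by
    rw [him]
    have := z.im_pos
    positivity⟩
  have hw (z : ℍ) : (w z : ℂ) = (A * z + B) / D := rfl
  have hden (z : ℍ) : sldenom γ z = (D : ℝ) * sldenom γ₁ (w z) := by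
    rw [sldenom, sldenom, hw, h₃, h₄]
    push_cast
    field_simp
    ring
  have hsmul (z : ℍ) : smul24 (γ • z) = γ₁ • w z := by
    refine UpperHalfPlane.ext ?_
    have h₁' := congrArg (Int.cast : ℤ → ℂ) h₁
    have h₂' := congrArg (Int.cast : ℤ → ℂ) h₂
    push_cast at h₁' h₂'
    rw [coe_smul24, coe_SL2Z_smul, coe_SL2Z_smul, hden, ← mul_div_assoc,
      div_eq_div_iff (mul_ne_zero (by exact_mod_cast hD.ne') (sldenom_ne_zero _ _))
        (sldenom_ne_zero _ _), ← mul_assoc]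
    congr 1
    rw [hw]
    push_cast
    field_simp
    linear_combination (z : ℂ) * h₁' + h₂'
  have hlim : Filter.Tendsto w atImInfty atImInfty := by
    refine Filter.tendsto_comap_iff.mpr ?_
    have : UpperHalfPlane.im ∘ w = fun z : ℍ ↦ A * z.im / D := funext him
    rw [this]
    exact (Filter.tendsto_comap.const_mul_atTop hA').atTop_div_const hD'
  have key := ((hf γ₁).comp hlim).const_mul (((D : ℝ) : ℂ) ^ s)
  rw [mul_zero] at key
  refine key.congr fun z ↦ ?_
  rw [Function.comp_apply, hsmul, hden, ofReal_mul_cpow hD' (sldenom_ne_zero _ _), mul_assoc]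

/-- if `(r,6) = 1` and `f ∈ S_k(N, χ ν_η^r)`, then
`f(24z) ∈ S_k(576N, χ (12/•) ν_θ^r)`. -/
theorem stmt4 (r : ℕ) (hr0 : 0 < r) (hr6 : Nat.gcd r 6 = 1)
    (N : ℕ) (hN : 0 < N) (χ : DirichletCharacter ℂ N)
    (k : ℝ) (hk : ∃ j : ℤ, 2 * k = (j : ℝ))
    (f : ℍ → ℂ)
    (hf : IsCuspForm N k (fun γ => χ ((γ 1 1 : ℤ) : ZMod N) * nuEta γ ^ r) f) :
    IsCuspForm (576 * N) k
      (fun γ => χ ((γ 1 1 : ℤ) : ZMod N) * ((kron12 (γ 1 1) : ℤ) : ℂ) * nuTheta γ ^ r)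
      (fun z => f (smul24 z)) := by
  refine ⟨mdifferentiable_comp_smul24 hf.1, fun γ hγ z ↦ ?_, isZeroAtImInfty_comp_smul24 hf.2.2⟩
  have hdvd : (576 * N : ℤ) ∣ γ 1 0 := by
    rw [Gamma0_mem, ZMod.intCast_zmod_eq_zero_iff_dvd] at hγ
    exact_mod_cast hγ
  have h576 : (576 : ℤ) ∣ γ 1 0 := (Dvd.intro _ rfl).trans hdvd
  have h24 : (24 : ℤ) ∣ γ 1 0 := (show (24 : ℤ) ∣ 576 by norm_num).trans h576
  have hmem : conj24 γ h24 ∈ Gamma0 N := by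
    rw [Gamma0_mem, ZMod.intCast_zmod_eq_zero_iff_dvd]
    refine Int.dvd_of_mul_dvd_mul_left (show (24 : ℤ) ≠ 0 by norm_num) ?_
    rw [conj24_lower_left]
    exact (show (24 * N : ℤ) ∣ 576 * N from mul_dvd_mul_right (by norm_num) _).trans hdvd
  have hodd : Odd r := by
    refine Nat.not_even_iff_odd.mp fun h ↦ ?_
    have := Nat.dvd_gcd h.two_dvd (show 2 ∣ 6 by norm_num)
    omega
  have key := hf.2.1 _ hmem (smul24 z)
  beta_reduce at key ⊢
  rw [← smul24_smul, sldenom_conj24, nuEta_conj24 h576, conj24_lower_right, mul_pow,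
    show (kron12 (γ 1 1) : ℂ) ^ r = kron12 (γ 1 1) by
      exact_mod_cast kron12_pow_of_odd (γ 1 1) hodd, ← mul_assoc] at key
  exact key
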